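/- Let a, b, n, m, ℓ be nonnegative integers with a + m = b + n = ℓ, and let σ ∈ S_a, τ ∈ S_b. Then the sum over all π ∈ S_ℓ(σ,τ) of p^{imaj(π_{>a})} q^{maj(π^{>b})} equals the sum over all j in the j_2-set J(σ,τ), with k = n - a + j, of p^{imaj(τ_{>j})} q^{maj(σ^{>j})} · [m choose k]_p · [n choose k]_q · A_k(p,q). -/

import Mathlib

open Finset

namespace QT

/-- The major index of a permutation of `Fin n` (sum of descents,
with positions written `1,...,n-1` as in one-line notation). -/
def maj {n : ℕ} (π : Equiv.Perm (Fin n)) : ℕ :=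
  ∑ i ∈ Finset.range n,
    if h : i + 1 < n then
      (if π ⟨i + 1, h⟩ < π ⟨i, by omega⟩ then i + 1 else 0)
    else 0

/-- `imaj π = maj π⁻¹`. -/
def imaj {n : ℕ} (π : Equiv.Perm (Fin n)) : ℕ := maj π⁻¹

/-- The permutation of `Fin k` order-isomorphic to the word `v 0, v 1, ..., v (k-1)`. -/
noncomputable def standardize {n k : ℕ} (v : Fin k → Fin n) (hv : Function.Injective v) :
    Equiv.Perm (Fin k) :=
  Equiv.ofBijective
    (fun i => (Finset.orderIsoOfFin (Finset.image v Finset.univ)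
        (by rw [Finset.card_image_of_injective _ hv, Finset.card_univ, Fintype.card_fin])).symm
        ⟨v i, Finset.mem_image_of_mem v (Finset.mem_univ i)⟩)
    (Finite.injective_iff_bijective.mp (fun i j hij => by
      have h2 := (Finset.orderIsoOfFin _ _).symm.injective hij
      exact hv (congrArg Subtype.val h2)))

/-- `π^{≤k}` : the permutation of `Fin k` order-isomorphic to the first `k` letters of `π`. -/
noncomputable def pInit {n : ℕ} (π : Equiv.Perm (Fin n)) (k : ℕ) (hk : k ≤ n) :
    Equiv.Perm (Fin k) :=
  standardize (fun i => π (Fin.castLE hk i))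
    (fun i j h => Fin.castLE_injective hk (π.injective h))

/-- `π^{>k}` : the permutation of `Fin (n-k)` order-isomorphic to the last `n - k` letters of `π`. -/
noncomputable def pTail {n : ℕ} (π : Equiv.Perm (Fin n)) (k : ℕ) :
    Equiv.Perm (Fin (n - k)) :=
  standardize (fun i => π ⟨k + (i : ℕ), by have := i.isLt; omega⟩)
    (fun i j h => by
      have h2 : k + (i : ℕ) = k + (j : ℕ) := congrArg Fin.val (π.injective h)
      exact Fin.ext (by omega))

/-- `π_{≤k}` : the permutation of `Fin k` order-isomorphic to the subword of `π`
consisting of the `k` smallest values.  (Equivalently `((π⁻¹)^{≤k})⁻¹`.) -/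
noncomputable def vLow {n : ℕ} (π : Equiv.Perm (Fin n)) (k : ℕ) (hk : k ≤ n) :
    Equiv.Perm (Fin k) := (pInit π⁻¹ k hk)⁻¹

/-- `π_{>k}` : the permutation of `Fin (n-k)` order-isomorphic to the subword of `π`
consisting of the values `> k`.  (Equivalently `((π⁻¹)^{>k})⁻¹`.) -/
noncomputable def vHigh {n : ℕ} (π : Equiv.Perm (Fin n)) (k : ℕ) :
    Equiv.Perm (Fin (n - k)) := (pTail π⁻¹ k)⁻¹

/-- The set `I_n` of involutions in `S_n`. -/
def involutions (n : ℕ) : Finset (Equiv.Perm (Fin n)) :=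
  Finset.univ.filter fun π => π * π = 1

-- `I_n(σ) = {π ∈ I_n : π_{≤m} = σ}`.
open scoped Classical in
noncomputable def involutionsC (n : ℕ) {m : ℕ} (σ : Equiv.Perm (Fin m)) :
    Finset (Equiv.Perm (Fin n)) :=
  (involutions n).filter fun π => ∃ h : m ≤ n, vLow π m h = σ

-- `S_n(σ,τ) = {π ∈ S_n : π_{≤a} = σ, π^{≤b} = τ}`.
open scoped Classical in
noncomputable def permsC (n : ℕ) {a b : ℕ} (σ : Equiv.Perm (Fin a)) (τ : Equiv.Perm (Fin b)) :
    Finset (Equiv.Perm (Fin n)) :=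
  Finset.univ.filter fun π => ∃ (ha : a ≤ n) (hb : b ≤ n), vLow π a ha = σ ∧ pInit π b hb = τ

-- The j-set `J(σ) = {j : σ^{≤j} is an involution}`.
open scoped Classical in
noncomputable def jSet {m : ℕ} (σ : Equiv.Perm (Fin m)) : Finset ℕ :=
  (Finset.range (m + 1)).filter fun j => ∃ h : j ≤ m, pInit σ j h * pInit σ j h = 1

-- The j₂-set `J(σ,τ) = {j : σ^{≤j} = τ_{≤j}}`.
open scoped Classical in
noncomputable def j2Set {a b : ℕ} (σ : Equiv.Perm (Fin a)) (τ : Equiv.Perm (Fin b)) :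
    Finset ℕ :=
  (Finset.range (min a b + 1)).filter fun j =>
    ∃ (ha : j ≤ a) (hb : j ≤ b), pInit σ j ha = vLow τ j hb

/-- A set of nonnegative integers is a j₂-set if it is `J(σ,τ)` for some pair of
permutations. -/
def IsJ2Set (S : Finset ℕ) : Prop :=
  ∃ (a b : ℕ) (σ : Equiv.Perm (Fin a)) (τ : Equiv.Perm (Fin b)), S = j2Set σ τ

-- The number of j₂-sets with largest element `n`.
open scoped Classical in
noncomputable def j2count (n : ℕ) : ℕ :=
  ((Finset.range (n + 1)).powerset.filter
    fun S => IsJ2Set S ∧ n ∈ S ∧ ∀ x ∈ S, x ≤ n).card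

/-- `[n]_q = 1 + q + ⋯ + q^{n-1}`. -/
def qInt (q : ℝ) (n : ℕ) : ℝ := ∑ i ∈ Finset.range n, q ^ i

/-- The q-factorial `[n]_q! = ∏_{i=1}^n (1 + q + ⋯ + q^{i-1})`. -/
def qFact (q : ℝ) (n : ℕ) : ℝ := ∏ i ∈ Finset.range n, qInt q (i + 1)

/-- The Gaussian binomial coefficient `[n choose k]_q = [n]_q!/([k]_q! [n-k]_q!)`,
defined via the q-Pascal recursion. -/
def qBinom (q : ℝ) : ℕ → ℕ → ℝ
  | _, 0 => 1
  | 0, _ + 1 => 0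
  | n + 1, k + 1 => qBinom q n k + q ^ (k + 1) * qBinom q n (k + 1)

/-- `t_n(q) = Σ_{π ∈ I_n} q^{maj π}`. -/
noncomputable def tq (q : ℝ) (n : ℕ) : ℝ := ∑ π ∈ involutions n, q ^ maj π

/-- `A_n(p,q) = Σ_{π ∈ S_n} p^{imaj π} q^{maj π}`. -/
noncomputable def Apq (p q : ℝ) (n : ℕ) : ℝ :=
  ∑ π : Equiv.Perm (Fin n), p ^ imaj π * q ^ maj π



/-! ### Gaussian binomial coefficients -/

theorem qBinom_zero_right (q : ℝ) (n : ℕ) : qBinom q n 0 = 1 := by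
  cases n <;> rfl

theorem qBinom_succ_succ (q : ℝ) (n k : ℕ) :
    qBinom q (n + 1) (k + 1) = qBinom q n k + q ^ (k + 1) * qBinom q n (k + 1) := rfl

theorem qBinom_eq_zero_of_lt (q : ℝ) {n k : ℕ} (h : n < k) : qBinom q n k = 0 := by
  induction n generalizing k with
  | zero =>
    obtain ⟨k, rfl⟩ := Nat.exists_eq_add_one_of_ne_zero h.ne'
    rfl
  | succ n ih =>
    obtain ⟨k, rfl⟩ := Nat.exists_eq_add_one_of_ne_zero (by omega : k ≠ 0)
    rw [qBinom_succ_succ, ih (by omega), ih (by omega)]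
    simp

theorem qBinom_self (q : ℝ) (n : ℕ) : qBinom q n n = 1 := by
  induction n with
  | zero => rfl
  | succ n ih => rw [qBinom_succ_succ, ih, qBinom_eq_zero_of_lt q (Nat.lt_succ_self n)]; simp

/-- The second `q`-Pascal recursion. -/
theorem qBinom_succ_succ' (q : ℝ) (r s : ℕ) :
    qBinom q (r + s + 1) (r + 1) = q ^ s * qBinom q (r + s) r + qBinom q (r + s) (r + 1) := by
  induction hN : r + s generalizing r s with
  | zero =>
    obtain ⟨rfl, rfl⟩ : r = 0 ∧ s = 0 := by omega
    simp [qBinom]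
  | succ N ih =>
    rcases s with _ | s
    · obtain rfl : r = N + 1 := by omega
      rw [qBinom_self, qBinom_self, qBinom_eq_zero_of_lt q (Nat.lt_succ_self _)]
      simp
    rcases r with _ | r
    · have h := ih 0 s (by omega)
      have h2 := qBinom_succ_succ q N 0
      rw [h, qBinom_zero_right] at h2
      rw [qBinom_succ_succ, h, qBinom_zero_right, qBinom_zero_right]
      linear_combination -h2
    · have h1 := ih r (s + 1) (by omega)
      have h2 := ih (r + 1) s (by omega)
      rw [qBinom_succ_succ q (N + 1), qBinom_succ_succ q N r, qBinom_succ_succ q N (r + 1)]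
      rw [qBinom_succ_succ] at h1 h2
      linear_combination h1 + q ^ (r + 2) * h2

theorem qBinom_symm (q : ℝ) (r s : ℕ) : qBinom q (r + s) r = qBinom q (r + s) s := by
  induction hN : r + s generalizing r s with
  | zero =>
    obtain ⟨rfl, rfl⟩ : r = 0 ∧ s = 0 := by omega
    rfl
  | succ N ih =>
    rcases s with _ | s
    · obtain rfl : r = N + 1 := by omega
      rw [qBinom_self, qBinom_zero_right]
    rcases r with _ | r
    · obtain rfl : s = N := by omega
      rw [qBinom_self, qBinom_zero_right]
    · have h := qBinom_succ_succ' q r (s + 1)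
      rw [show r + (s + 1) = N by omega] at h
      rw [h, qBinom_succ_succ, ih r (s + 1) (by omega), ih (r + 1) s (by omega)]
      ring

/-! ### The major index of a word and the shuffle theorem -/

/-- The major index of the word `w 0, ..., w (n - 1)`. -/
def wordMaj (n : ℕ) (w : ℕ → ℕ) : ℕ :=
  ∑ i ∈ range n, if w i < w (i - 1) then i else 0

theorem wordMaj_succ (n : ℕ) (w : ℕ → ℕ) :
    wordMaj (n + 1) w = wordMaj n w + if w n < w (n - 1) then n else 0 :=
  sum_range_succ _ _

theorem wordMaj_congr_lt {n : ℕ} {w w' : ℕ → ℕ}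
    (h : ∀ i j, i < n → j < n → (w i < w j ↔ w' i < w' j)) : wordMaj n w = wordMaj n w' := by
  refine sum_congr rfl fun i hi => ?_
  have hi := mem_range.1 hi
  simp only [h i (i - 1) hi (by omega)]

theorem wordMaj_congr {n : ℕ} {w w' : ℕ → ℕ} (h : ∀ i < n, w i = w' i) :
    wordMaj n w = wordMaj n w' :=
  wordMaj_congr_lt fun i j hi hj => by rw [h i hi, h j hj]

/-- The shuffle of the words `u` and `v` in which the letters of `u` occupy the positions in `L`. -/
def shuffle (L : Finset ℕ) (u v : ℕ → ℕ) (i : ℕ) : ℕ :=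
  if i ∈ L then u (Nat.count (· ∈ L) i) else v (Nat.count (· ∉ L) i)

theorem count_mem_eq_card (L : Finset ℕ) (n : ℕ) (hL : L ⊆ range n) :
    Nat.count (· ∈ L) n = #L := by
  rw [Nat.count_eq_card_filter_range, filter_mem_eq_inter, inter_eq_right.2 hL]

theorem count_not_add_count (p : ℕ → Prop) [DecidablePred p] (n : ℕ) :
    Nat.count (fun i => ¬ p i) n + Nat.count p n = n := by
  induction n with
  | zero => simp
  | succ n ih =>
    rw [Nat.count_succ, Nat.count_succ]
    split_ifs <;> omega

theorem count_congr {p p' : ℕ → Prop} [DecidablePred p] [DecidablePred p'] {n : ℕ}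
    (h : ∀ i < n, p i ↔ p' i) : Nat.count p n = Nat.count p' n := by
  rw [Nat.count_eq_card_filter_range, Nat.count_eq_card_filter_range]
  exact congrArg card (filter_congr fun i hi => h i (mem_range.1 hi))

theorem shuffle_insert_of_lt {L : Finset ℕ} {n i : ℕ} (h : i < n) (u v : ℕ → ℕ) :
    shuffle (insert n L) u v i = shuffle L u v i := by
  have h1 : ∀ j ≤ i, (j ∈ insert n L ↔ j ∈ L) := fun j hj => by
    rw [mem_insert, or_iff_right (by omega)]
  unfold shuffle
  rw [count_congr fun j hj => h1 j hj.le, count_congr fun j hj => not_congr (h1 j hj.le)]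
  simp only [h1 i le_rfl]

theorem shuffle_insert_self {L : Finset ℕ} {n r : ℕ}
    (hL : L ∈ powersetCard r (range n)) (u v : ℕ → ℕ) :
    shuffle (insert n L) u v n = u r := by
  obtain ⟨h1, h2⟩ := mem_powersetCard.1 hL
  unfold shuffle
  rw [if_pos (mem_insert_self _ _), count_congr (p' := (· ∈ L)), count_mem_eq_card L _ h1, h2]
  intro i hi
  rw [mem_insert, or_iff_right (by omega)]

theorem shuffle_last {L : Finset ℕ} {n r s : ℕ} (hn : r + s = n)
    (hL : L ∈ powersetCard r (range n)) (u v : ℕ → ℕ) :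
    shuffle L u v n = v s := by
  obtain ⟨h1, h2⟩ := mem_powersetCard.1 hL
  have h3 := count_not_add_count (· ∈ L) n
  rw [count_mem_eq_card L _ h1] at h3
  unfold shuffle
  rw [if_neg fun h => by simpa using h1 h]
  congr 1
  omega

/-- The sum of `q ^ maj` over the shuffles of `u 0, ..., u r` and `v 0, ..., v (n - r - 1)` that end
with `u r`. -/
noncomputable def shuffleSumL (q : ℝ) (u v : ℕ → ℕ) (n r : ℕ) : ℝ :=
  ∑ L ∈ powersetCard r (range n), q ^ wordMaj (n + 1) (shuffle (insert n L) u v)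

/-- The sum of `q ^ maj` over the shuffles of `u 0, ..., u (r - 1)` and `v 0, ..., v (n - r)` that
end with `v (n - r)`. -/
noncomputable def shuffleSumR (q : ℝ) (u v : ℕ → ℕ) (n r : ℕ) : ℝ :=
  ∑ L ∈ powersetCard r (range n), q ^ wordMaj (n + 1) (shuffle L u v)

theorem sum_powersetCard_succ_range (n r : ℕ) (f : Finset ℕ → ℝ) :
    ∑ L ∈ powersetCard (r + 1) (range (n + 1)), f L =
      ∑ L ∈ powersetCard (r + 1) (range n), f L +
        ∑ L ∈ powersetCard r (range n), f (insert n L) := by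
  rw [range_add_one, powersetCard_succ_insert notMem_range_self, sum_union, sum_image]
  · intro L hL L' hL' h
    have h1 : n ∉ L := fun h => by simpa using (mem_powersetCard.1 hL).1 h
    have h2 : n ∉ L' := fun h => by simpa using (mem_powersetCard.1 hL').1 h
    rw [← erase_insert h1, ← erase_insert h2, h]
  · rw [disjoint_left]
    rintro L hL hL'
    obtain ⟨M, -, rfl⟩ := mem_image.1 hL'
    simpa using (mem_powersetCard.1 hL).1 (mem_insert_self n M)

theorem wordMaj_shuffle_insert (n : ℕ) (L : Finset ℕ) (u v : ℕ → ℕ) :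
    wordMaj n (shuffle (insert n L) u v) = wordMaj n (shuffle L u v) :=
  wordMaj_congr fun _ hi => shuffle_insert_of_lt hi u v

theorem mem_powersetCard_range_succ {L : Finset ℕ} {n r : ℕ} (hL : L ∈ powersetCard r (range n)) :
    L ∈ powersetCard r (range (n + 1)) :=
  powersetCard_mono (range_subset_range.2 n.le_succ) hL

theorem insert_mem_powersetCard_range_succ {L : Finset ℕ} {n r : ℕ}
    (hL : L ∈ powersetCard r (range n)) :
    insert n L ∈ powersetCard (r + 1) (range (n + 1)) := by
  obtain ⟨h1, h2⟩ := mem_powersetCard.1 hL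
  rw [mem_powersetCard, card_insert_of_notMem fun h => by simpa using h1 h, h2]
  exact ⟨insert_subset (by simp) (h1.trans (range_subset_range.2 n.le_succ)), rfl⟩

section Recursions

variable (q : ℝ) (u v : ℕ → ℕ) {n r s : ℕ}

theorem sum_left_after_right (hn : r + s = n) (huv : u r < v s) :
    ∑ L ∈ powersetCard r (range n), q ^ wordMaj (n + 2) (shuffle (insert (n + 1) L) u v) =
      q ^ (n + 1) * shuffleSumR q u v n r := by
  rw [shuffleSumR, mul_sum]
  refine sum_congr rfl fun L hL => ?_
  rw [wordMaj_succ, wordMaj_shuffle_insert, Nat.add_sub_cancel,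
    shuffle_insert_of_lt (Nat.lt_succ_self _), shuffle_last hn hL,
    shuffle_insert_self (mem_powersetCard_range_succ hL), if_pos huv, pow_add, mul_comm]

theorem sum_left_after_left :
    ∑ L ∈ powersetCard r (range n),
        q ^ wordMaj (n + 2) (shuffle (insert (n + 1) (insert n L)) u v) =
      q ^ (if u (r + 1) < u r then n + 1 else 0) * shuffleSumL q u v n r := by
  rw [shuffleSumL, mul_sum]
  refine sum_congr rfl fun L hL => ?_
  rw [wordMaj_succ, wordMaj_shuffle_insert, Nat.add_sub_cancel,
    shuffle_insert_of_lt (Nat.lt_succ_self _),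
    shuffle_insert_self (insert_mem_powersetCard_range_succ hL), shuffle_insert_self hL, pow_add,
    mul_comm]

theorem sum_right_after_right (hn : r + s = n) :
    ∑ L ∈ powersetCard r (range n), q ^ wordMaj (n + 2) (shuffle L u v) =
      q ^ (if v (s + 1) < v s then n + 1 else 0) * shuffleSumR q u v n r := by
  rw [shuffleSumR, mul_sum]
  refine sum_congr rfl fun L hL => ?_
  rw [wordMaj_succ, Nat.add_sub_cancel,
    shuffle_last (s := s + 1) (by omega) (mem_powersetCard_range_succ hL), shuffle_last hn hL,
    pow_add, mul_comm]

theorem sum_right_after_left (hn : r + s = n) (huv : u r < v s) :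
    ∑ L ∈ powersetCard r (range n), q ^ wordMaj (n + 2) (shuffle (insert n L) u v) =
      shuffleSumL q u v n r := by
  rw [shuffleSumL]
  refine sum_congr rfl fun L hL => ?_
  rw [wordMaj_succ, Nat.add_sub_cancel,
    shuffle_last (s := s) (by omega) (insert_mem_powersetCard_range_succ hL),
    shuffle_insert_self hL, if_neg huv.not_gt, add_zero]

end Recursions

theorem powersetCard_succ_range_self (r : ℕ) : powersetCard (r + 1) (range r) = ∅ :=
  powersetCard_eq_empty.2 (by simp)

theorem shuffleSum_eq (q : ℝ) (u v : ℕ → ℕ) (R S : ℕ) (huv : ∀ i < R, ∀ j < S, u i < v j)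
    (n r s : ℕ) (hn : r + s = n) :
    (r < R → s ≤ S → shuffleSumL q u v n r =
      q ^ (wordMaj (r + 1) u + wordMaj s v + s) * qBinom q n r) ∧
    (r ≤ R → s < S → shuffleSumR q u v n r =
      q ^ (wordMaj r u + wordMaj (s + 1) v) * qBinom q n r) := by
  induction n generalizing r s with
  | zero =>
    obtain ⟨rfl, rfl⟩ : r = 0 ∧ s = 0 := by omega
    simp [shuffleSumL, shuffleSumR, wordMaj, qBinom]
  | succ N ih =>
    rcases s with _ | s
    · obtain rfl : r = N + 1 := hn
      have h1 := (ih N 0 rfl).1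
      refine ⟨fun hr hs => ?_, fun hr hs => ?_⟩
      · rw [shuffleSumL, sum_powersetCard_succ_range, powersetCard_succ_range_self, sum_empty,
          sum_left_after_left, h1 (by omega) hs, wordMaj_succ (N + 1), qBinom_self, qBinom_self,
          Nat.add_sub_cancel]
        ring
      · rw [shuffleSumR, sum_powersetCard_succ_range, powersetCard_succ_range_self, sum_empty,
          sum_right_after_left q u v (n := N) (s := 0) rfl (huv N (by omega) _ hs),
          h1 (by omega) hs.le, qBinom_self, qBinom_self]
        simp [wordMaj]
    rcases r with _ | r
    · obtain rfl : s = N := by omega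
      have h2 := (ih 0 s (by omega)).2
      refine ⟨fun hr hs => ?_, fun hr hs => ?_⟩
      · rw [shuffleSumL, powersetCard_zero, ← powersetCard_zero (range s),
          sum_left_after_right q u v (s := s) (by omega) (huv _ hr _ hs), h2 (by omega) hs,
          qBinom_zero_right, qBinom_zero_right]
        simp [wordMaj]
        ring
      · rw [shuffleSumR, powersetCard_zero, ← powersetCard_zero (range s),
          sum_right_after_right q u v (s := s) (by omega), h2 hr (by omega), wordMaj_succ (s + 1),
          qBinom_zero_right, qBinom_zero_right, Nat.add_sub_cancel]
        ring
    · have h1 := (ih r (s + 1) (by omega)).1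
      have h2 := (ih (r + 1) s (by omega)).2
      have hP := qBinom_succ_succ' q r (s + 1)
      rw [show r + (s + 1) = N by omega] at hP
      obtain rfl : N = r + s + 1 := by omega
      refine ⟨fun hr hs => ?_, fun hr hs => ?_⟩
      · rw [shuffleSumL, sum_powersetCard_succ_range,
          sum_left_after_right q u v (s := s) (by omega) (huv _ hr _ hs),
          sum_left_after_left, h1 (by omega) hs, h2 hr.le hs, wordMaj_succ (r + 1) u,
          Nat.add_sub_cancel]
        split_ifs
        · rw [hP]; ring
        · rw [qBinom_succ_succ q (r + s + 1)]; ring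
      · rw [shuffleSumR, sum_powersetCard_succ_range,
          sum_right_after_right q u v (s := s) (by omega),
          sum_right_after_left q u v (s := s + 1) (by omega) (huv _ (by omega) _ hs),
          h1 (by omega) hs.le, h2 hr (by omega), wordMaj_succ (s + 1) v,
          Nat.add_sub_cancel]
        split_ifs
        · rw [qBinom_succ_succ q (r + s + 1)]; ring
        · rw [hP]; ring

/-- The generating function of the major index over the shuffles of two words, all letters of the
first being smaller than those of the second. -/
theorem sum_shuffle (q : ℝ) (u v : ℕ → ℕ) (r s : ℕ) (huv : ∀ i < r, ∀ j < s, u i < v j) :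
    ∑ L ∈ powersetCard r (range (r + s)), q ^ wordMaj (r + s) (shuffle L u v) =
      q ^ (wordMaj r u + wordMaj s v) * qBinom q (r + s) r := by
  rcases s with _ | s
  · rcases r with _ | r
    · simp [wordMaj, qBinom]
    · rw [add_zero, sum_powersetCard_succ_range, powersetCard_succ_range_self, sum_empty,
        ← shuffleSumL, (shuffleSum_eq q u v _ _ huv r r 0 rfl).1 (by omega) le_rfl, qBinom_self,
        qBinom_self]
      simp
  · rcases r with _ | r
    · rw [powersetCard_zero, ← powersetCard_zero (range s), ← add_assoc, zero_add, ← shuffleSumR,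
        (shuffleSum_eq q u v _ _ huv s 0 s (by omega)).2 le_rfl (by omega), qBinom_zero_right,
        qBinom_zero_right]
    · have hP := qBinom_succ_succ' q r (s + 1)
      rw [show r + 1 + (s + 1) = r + (s + 1) + 1 by omega, sum_powersetCard_succ_range,
        ← shuffleSumL, ← shuffleSumR,
        (shuffleSum_eq q u v _ _ huv _ r (s + 1) rfl).1 (by omega) le_rfl,
        (shuffleSum_eq q u v _ _ huv _ (r + 1) s (by omega)).2 le_rfl (by omega), hP]
      ring

/-! ### Permutations as words -/

/-- The one-line notation of `π` as a word indexed by `ℕ`, extended by the identity. -/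
def word {n : ℕ} (π : Equiv.Perm (Fin n)) (i : ℕ) : ℕ :=
  if h : i < n then π ⟨i, h⟩ else i

section Word

variable {n : ℕ} (π : Equiv.Perm (Fin n))

theorem word_of_lt {i : ℕ} (h : i < n) : word π i = π ⟨i, h⟩ := dif_pos h

theorem word_of_le {i : ℕ} (h : n ≤ i) : word π i = i := dif_neg h.not_gt

theorem word_lt {i : ℕ} (h : i < n) : word π i < n := by
  rw [word_of_lt π h]
  exact (π _).isLt

theorem word_lt_iff {i : ℕ} : word π i < n ↔ i < n := by
  refine ⟨fun h => ?_, word_lt π⟩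
  by_contra h'
  rw [word_of_le π (not_lt.1 h')] at h
  exact h' h

theorem word_inv_word (i : ℕ) : word π⁻¹ (word π i) = i := by
  rcases lt_or_ge i n with h | h
  · rw [word_of_lt _ (word_lt π h)]
    simp [word_of_lt π h]
  · rw [word_of_le π h, word_of_le _ h]

theorem word_word_inv (i : ℕ) : word π (word π⁻¹ i) = i := by
  simpa using word_inv_word π⁻¹ i

theorem word_injective : Function.Injective (word π) := fun i j h => by
  rw [← word_inv_word π i, h, word_inv_word]

theorem word_lt_word_iff {i j : ℕ} (hi : i < n) (hj : j < n) :
    word π i < word π j ↔ π ⟨i, hi⟩ < π ⟨j, hj⟩ := by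
  rw [word_of_lt π hi, word_of_lt π hj, Fin.lt_def]

theorem maj_eq_wordMaj : maj π = wordMaj n (word π) := by
  rcases n with _ | n
  · simp [maj, wordMaj]
  · rw [maj, wordMaj, sum_range_succ, sum_range_succ', dif_neg (lt_irrefl _)]
    refine congrArg₂ _ ?_ (by simp)
    refine sum_congr rfl fun i hi => ?_
    have hi := mem_range.1 hi
    rw [dif_pos (Nat.succ_lt_succ hi), Nat.add_sub_cancel]
    simp only [word_lt_word_iff π (Nat.succ_lt_succ hi) (hi.trans n.lt_succ_self)]

theorem word_eq_card {x : ℕ} (hx : x < n) :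
    word π x = #{y ∈ range n | word π y < word π x} := by
  conv_lhs => rw [← card_range (word π x)]
  refine card_nbij' (word π⁻¹) (word π) ?_ ?_ (fun y _ => word_word_inv π y)
    fun y _ => word_inv_word π y
  · intro y hy
    have hy : y < word π x := by simpa using hy
    have := hy.trans (word_lt π hx)
    simp [word_word_inv, hy, word_lt_iff, this]
  · intro y hy
    simp only [coe_filter, Set.mem_ofPred_eq] at hy
    simpa using hy.2

variable {π} in
theorem perm_ext_of_lt_iff {π' : Equiv.Perm (Fin n)}
    (h : ∀ x < n, ∀ y < n, word π x < word π y ↔ word π' x < word π' y) : π = π' := by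
  ext x
  rw [← word_of_lt π x.isLt, ← word_of_lt π' x.isLt, word_eq_card π x.isLt,
    word_eq_card π' x.isLt]
  exact congrArg card (filter_congr fun y hy => h y (mem_range.1 hy) x x.isLt)

theorem standardize_lt_iff {k : ℕ} (v : Fin k → Fin n) (hv : Function.Injective v) (i j : Fin k) :
    standardize v hv i < standardize v hv j ↔ v i < v j := by
  simp only [standardize, Equiv.ofBijective_apply, OrderIso.lt_iff_lt, Subtype.mk_lt_mk]

theorem word_pInit_lt_iff {k : ℕ} (hk : k ≤ n) {x y : ℕ} (hx : x < k) (hy : y < k) :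
    word (pInit π k hk) x < word (pInit π k hk) y ↔ word π x < word π y := by
  rw [word_lt_word_iff _ hx hy, word_lt_word_iff π (hx.trans_le hk) (hy.trans_le hk)]
  exact standardize_lt_iff _ _ _ _

theorem word_pTail_lt_iff {k : ℕ} {x y : ℕ} (hx : x < n - k) (hy : y < n - k) :
    word (pTail π k) x < word (pTail π k) y ↔ word π (k + x) < word π (k + y) := by
  rw [word_lt_word_iff _ hx hy,
    word_lt_word_iff π (by omega : k + x < n) (by omega : k + y < n)]
  exact standardize_lt_iff _ _ _ _

theorem maj_pTail (k : ℕ) : maj (pTail π k) = wordMaj (n - k) fun i => word π (k + i) := by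
  rw [maj_eq_wordMaj]
  exact wordMaj_congr_lt fun i j hi hj => word_pTail_lt_iff π hi hj

/-- The set of positions of the letters of `π` that are smaller than `c`. -/
def lowPos (c : ℕ) : Finset ℕ := {i ∈ range n | word π i < c}

theorem mem_lowPos {c i : ℕ} (hi : i < n) : i ∈ lowPos π c ↔ word π i < c := by
  simp [lowPos, hi]

theorem card_lowPos {c : ℕ} (hc : c ≤ n) : #(lowPos π c) = c := by
  conv_rhs => rw [← card_range c]
  refine card_nbij' (word π) (word π⁻¹) ?_ ?_ (fun y _ => word_inv_word π y)
    fun y _ => word_word_inv π y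
  · intro y hy
    simp only [lowPos, coe_filter, Set.mem_ofPred_eq] at hy
    simpa using hy.2
  · intro y hy
    have hy : y < c := by simpa using hy
    simp [lowPos, word_word_inv, hy, word_lt_iff, hy.trans_le hc]

theorem lowPos_mem_powersetCard {c : ℕ} (hc : c ≤ n) :
    lowPos π c ∈ powersetCard c (range n) :=
  mem_powersetCard.2 ⟨filter_subset _ _, card_lowPos π hc⟩

theorem count_lowPos {c : ℕ} (hc : c ≤ n) : Nat.count (· ∈ lowPos π c) n = c := by
  rw [count_mem_eq_card (lowPos π c) n (filter_subset _ _), card_lowPos π hc]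

theorem word_vLow {c i : ℕ} (hc : c ≤ n) (h : word π i < c) :
    word (vLow π c hc) (Nat.count (· ∈ lowPos π c) i) = word π i := by
  have hi : i < n := (word_lt_iff π).1 (h.trans_le hc)
  suffices hs : word (pInit π⁻¹ c hc) (word π i) = Nat.count (· ∈ lowPos π c) i by
    rw [← hs, vLow, word_inv_word]
  rw [word_eq_card _ h, Nat.count_eq_card_filter_range]
  refine card_nbij' (word π⁻¹) (word π) ?_ ?_ (fun y _ => word_word_inv π y)
    fun y _ => word_inv_word π y
  · intro y hy
    simp only [coe_filter, Set.mem_ofPred_eq, mem_range] at hy ⊢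
    obtain ⟨hy1, hy2⟩ := hy
    rw [word_pInit_lt_iff _ _ hy1 h, word_inv_word] at hy2
    rw [mem_lowPos _ (hy2.trans hi), word_word_inv]
    exact ⟨hy2, hy1⟩
  · intro y hy
    simp only [coe_filter, Set.mem_ofPred_eq, mem_range] at hy ⊢
    obtain ⟨hy1, hy2⟩ := hy
    rw [mem_lowPos _ (hy1.trans hi)] at hy2
    rw [word_pInit_lt_iff _ _ hy2 h, word_inv_word, word_inv_word]
    exact ⟨hy2, hy1⟩

theorem word_vHigh {c i : ℕ} (hi : i < n) (h : c ≤ word π i) :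
    c + word (vHigh π c) (Nat.count (· ∉ lowPos π c) i) = word π i := by
  have hn := word_lt π hi
  have hk : word π i - c < n - c := by omega
  suffices hs : word (pTail π⁻¹ c) (word π i - c) = Nat.count (· ∉ lowPos π c) i by
    rw [← hs, vHigh, word_inv_word]
    omega
  rw [word_eq_card _ hk, Nat.count_eq_card_filter_range]
  refine card_nbij' (fun y => word π⁻¹ (c + y)) (fun y => word π y - c) ?_ ?_ ?_ ?_
  · intro y hy
    simp only [coe_filter, Set.mem_ofPred_eq, mem_range] at hy ⊢
    obtain ⟨hy1, hy2⟩ := hy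
    rw [word_pTail_lt_iff _ hy1 hk, Nat.add_sub_cancel' h, word_inv_word] at hy2
    rw [mem_lowPos _ (hy2.trans hi), word_word_inv]
    exact ⟨hy2, by omega⟩
  · intro y hy
    simp only [coe_filter, Set.mem_ofPred_eq, mem_range] at hy ⊢
    obtain ⟨hy1, hy2⟩ := hy
    rw [mem_lowPos _ (hy1.trans hi), not_lt] at hy2
    have hy3 := word_lt π (hy1.trans hi)
    have hy4 : word π y - c < n - c := by omega
    rw [word_pTail_lt_iff _ hy4 hk, Nat.add_sub_cancel' h, Nat.add_sub_cancel' hy2, word_inv_word,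
      word_inv_word]
    exact ⟨hy4, hy1⟩
  · intro y _
    simp [word_word_inv]
  · intro y hy
    simp only [coe_filter, Set.mem_ofPred_eq, mem_range] at hy
    obtain ⟨hy1, hy2⟩ := hy
    rw [mem_lowPos _ (hy1.trans hi), not_lt] at hy2
    simp [Nat.add_sub_cancel' hy2, word_inv_word]

theorem word_eq_shuffle {c : ℕ} (hc : c ≤ n) {i : ℕ} (hi : i < n) :
    word π i = shuffle (lowPos π c) (word (vLow π c hc)) (fun t => c + word (vHigh π c) t) i := by
  unfold shuffle
  split_ifs with h
  · exact (word_vLow π hc ((mem_lowPos π hi).1 h)).symm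
  · exact (word_vHigh π hi (not_lt.1 fun h' => h ((mem_lowPos π hi).2 h'))).symm

theorem exists_count_lowPos_eq {c : ℕ} (hc : c ≤ n) {x : ℕ} (hx : x < c) :
    ∃ i < n, word π i < c ∧ Nat.count (· ∈ lowPos π c) i = x := by
  have h1 := word_lt (vLow π c hc) hx
  have h2 := word_word_inv π (word (vLow π c hc) x)
  refine ⟨word π⁻¹ (word (vLow π c hc) x), word_lt _ (h1.trans_le hc), h2.trans_lt h1, ?_⟩
  exact word_injective (vLow π c hc) ((word_vLow π hc (h2.trans_lt h1)).trans h2)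

theorem exists_count_notMem_lowPos_eq {c x : ℕ} (hx : x < n - c) :
    ∃ i < n, c ≤ word π i ∧ Nat.count (· ∉ lowPos π c) i = x := by
  have h1 := word_lt (vHigh π c) hx
  have h2 := word_word_inv π (c + word (vHigh π c) x)
  have h3 : word π⁻¹ (c + word (vHigh π c) x) < n := word_lt _ (by omega)
  refine ⟨_, h3, by omega, ?_⟩
  exact word_injective (vHigh π c) (Nat.add_left_cancel
    ((word_vHigh π h3 (by omega : c ≤ _)).trans h2))

variable {π} in
theorem eq_of_decomposition {π' : Equiv.Perm (Fin n)} {c : ℕ} (hc : c ≤ n)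
    (h1 : lowPos π c = lowPos π' c) (h2 : vLow π c hc = vLow π' c hc)
    (h3 : vHigh π c = vHigh π' c) : π = π' := by
  ext x
  rw [← word_of_lt π x.isLt, ← word_of_lt π' x.isLt, word_eq_shuffle π hc x.isLt,
    word_eq_shuffle π' hc x.isLt, h1, h2, h3]

end Word

/-- The decomposition of a permutation into the positions of its letters smaller than `c` and the
patterns of its small and of its large letters. -/
noncomputable def decompose {n c : ℕ} (hc : c ≤ n) (π : Equiv.Perm (Fin n)) :
    powersetCard c (range n) × Equiv.Perm (Fin c) × Equiv.Perm (Fin (n - c)) :=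
  (⟨lowPos π c, lowPos_mem_powersetCard π hc⟩, vLow π c hc, vHigh π c)

theorem decompose_bijective {n c : ℕ} (hc : c ≤ n) : Function.Bijective (decompose hc) := by
  rw [Fintype.bijective_iff_injective_and_card]
  constructor
  · intro π π' h
    simp only [decompose, Prod.mk.injEq, Subtype.mk.injEq] at h
    exact eq_of_decomposition hc h.1 h.2.1 h.2.2
  · simp only [Fintype.card_prod, Fintype.card_perm, Fintype.card_fin, Fintype.card_coe,
      card_powersetCard, card_range]
    rw [← mul_assoc, Nat.choose_mul_factorial_mul_factorial hc]

theorem exists_decomposition {n c : ℕ} (hc : c ≤ n) {L : Finset ℕ}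
    (hL : L ∈ powersetCard c (range n)) (σ : Equiv.Perm (Fin c)) (ρ : Equiv.Perm (Fin (n - c))) :
    ∃ π : Equiv.Perm (Fin n), lowPos π c = L ∧ vLow π c hc = σ ∧ vHigh π c = ρ := by
  obtain ⟨π, hπ⟩ := (decompose_bijective hc).2 (⟨L, hL⟩, σ, ρ)
  simp only [decompose, Prod.mk.injEq, Subtype.mk.injEq] at hπ
  exact ⟨π, hπ⟩

theorem sum_decomposition {n c : ℕ} (hc : c ≤ n)
    (f : Finset ℕ → Equiv.Perm (Fin c) → Equiv.Perm (Fin (n - c)) → ℝ) :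
    ∑ π, f (lowPos π c) (vLow π c hc) (vHigh π c) =
      ∑ σ, ∑ ρ, ∑ L ∈ powersetCard c (range n), f L σ ρ := by
  refine (Fintype.sum_bijective _ (decompose_bijective hc) _ (fun x => f x.1 x.2.1 x.2.2)
    fun _ => rfl).trans ?_
  rw [Fintype.sum_prod_type_right, Fintype.sum_prod_type]
  refine sum_congr rfl fun σ _ => sum_congr rfl fun ρ _ => ?_
  exact sum_coe_sort (powersetCard c (range n)) fun L => f L σ ρ

theorem Apq_eq_sum_inv (p q : ℝ) (n : ℕ) :
    Apq p q n = ∑ π : Equiv.Perm (Fin n), p ^ maj π * q ^ imaj π :=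
  Fintype.sum_equiv (Equiv.inv _) _ _ fun π => by simp [imaj]

theorem wordMaj_add_left (n c : ℕ) (w : ℕ → ℕ) : wordMaj n (fun i => c + w i) = wordMaj n w :=
  wordMaj_congr_lt fun _ _ _ _ => by simp

open scoped Classical in
theorem sum_pInit_eq {m c : ℕ} (hc : c ≤ m) (κ : Equiv.Perm (Fin c)) (p q : ℝ) :
    ∑ α : Equiv.Perm (Fin m) with pInit α c hc = κ, p ^ imaj α * q ^ maj (pTail α c) =
      p ^ imaj κ * qBinom p m c * Apq p q (m - c) := by
  let f (L : Finset ℕ) (σ : Equiv.Perm (Fin c)) (ρ : Equiv.Perm (Fin (m - c))) : ℝ :=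
    if σ = κ⁻¹ then p ^ wordMaj m (shuffle L (word σ) fun t => c + word ρ t) * q ^ imaj ρ else 0
  have h1 : ∑ α : Equiv.Perm (Fin m) with pInit α c hc = κ, p ^ imaj α * q ^ maj (pTail α c) =
      ∑ γ : Equiv.Perm (Fin m), f (lowPos γ c) (vLow γ c hc) (vHigh γ c) := by
    rw [sum_filter]
    refine Fintype.sum_equiv (Equiv.inv _) _ _ fun α => ?_
    simp only [f, Equiv.inv_apply, imaj, vLow, vHigh, inv_inv, inv_inj]
    rw [maj_eq_wordMaj α⁻¹, wordMaj_congr fun i hi => word_eq_shuffle α⁻¹ hc hi]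
    simp only [vLow, vHigh, inv_inv]
  rw [h1, sum_decomposition hc, Fintype.sum_eq_single κ⁻¹ fun σ hσ => by simp [f, hσ],
    Apq_eq_sum_inv, mul_sum]
  refine sum_congr rfl fun ρ _ => ?_
  have h2 := sum_shuffle p (word κ⁻¹) (fun t => c + word ρ t) c (m - c) fun i hi j _ =>
    (word_lt _ hi).trans_le (Nat.le_add_right _ _)
  rw [Nat.add_sub_cancel' hc, wordMaj_add_left, ← maj_eq_wordMaj, ← maj_eq_wordMaj] at h2
  simp only [f, if_true]
  rw [← sum_mul, h2, pow_add]
  simp only [imaj]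
  ring

/-! ### Restriction to initial positions -/

section Restriction

variable {n : ℕ} (π : Equiv.Perm (Fin n)) {a b j : ℕ}

theorem count_notMem (L : Finset ℕ) {b j : ℕ} (hj : Nat.count (· ∈ L) b = j) :
    Nat.count (· ∉ L) b = b - j := by
  have := count_not_add_count (· ∈ L) b
  omega

theorem word_pInit_lt_count_iff (hb : b ≤ n) (hj : Nat.count (· ∈ lowPos π a) b = j) {i : ℕ}
    (hi : i < b) : word (pInit π b hb) i < j ↔ word π i < a := by
  have h1 : word (pInit π b hb) i = #{y ∈ range b | word π y < word π i} := by
    rw [word_eq_card _ hi]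
    exact congrArg card (filter_congr fun y hy => word_pInit_lt_iff π hb (mem_range.1 hy) hi)
  have h2 : j = #{y ∈ range b | word π y < a} := by
    rw [← hj, Nat.count_eq_card_filter_range]
    exact congrArg card (filter_congr fun y hy => mem_lowPos π ((mem_range.1 hy).trans_le hb))
  rw [h1, h2]
  constructor
  · intro h
    by_contra h'
    refine h.not_ge (card_le_card fun y hy => ?_)
    rw [mem_filter] at hy ⊢
    exact ⟨hy.1, by omega⟩
  · intro h
    refine card_lt_card (ssubset_iff_of_subset (fun y hy => ?_) |>.2 ⟨i, ?_, ?_⟩)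
    · rw [mem_filter] at hy ⊢
      exact ⟨hy.1, by omega⟩
    · simp [hi, h]
    · simp

theorem mem_lowPos_pInit (hb : b ≤ n) (hj : Nat.count (· ∈ lowPos π a) b = j) {i : ℕ}
    (hi : i < b) : i ∈ lowPos (pInit π b hb) j ↔ i ∈ lowPos π a := by
  rw [mem_lowPos _ hi, mem_lowPos _ (hi.trans_le hb), word_pInit_lt_count_iff π hb hj hi]

theorem vLow_pInit (ha : a ≤ n) (hb : b ≤ n) (hj : Nat.count (· ∈ lowPos π a) b = j)
    (hja : j ≤ a) (hjb : j ≤ b) :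
    vLow (pInit π b hb) j hjb = pInit (vLow π a ha) j hja := by
  have key : ∀ x < j, ∃ i < b, word (vLow (pInit π b hb) j hjb) x = word (pInit π b hb) i ∧
      word (vLow π a ha) x = word π i := by
    intro x hx
    obtain ⟨i, hi, hij, rfl⟩ := exists_count_lowPos_eq (pInit π b hb) hjb hx
    refine ⟨i, hi, word_vLow _ hjb hij, ?_⟩
    rw [count_congr fun t ht => mem_lowPos_pInit π hb hj (ht.trans hi)]
    exact word_vLow π ha ((word_pInit_lt_count_iff π hb hj hi).1 hij)
  refine perm_ext_of_lt_iff fun x hx y hy => ?_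
  obtain ⟨i, hi, h1, h2⟩ := key x hx
  obtain ⟨i', hi', h3, h4⟩ := key y hy
  rw [word_pInit_lt_iff _ hja hx hy, h1, h2, h3, h4, word_pInit_lt_iff π hb hi hi']

theorem vHigh_pInit (hb : b ≤ n) (hj : Nat.count (· ∈ lowPos π a) b = j)
    (hjb : b - j ≤ n - a) :
    vHigh (pInit π b hb) j = pInit (vHigh π a) (b - j) hjb := by
  have key : ∀ x < b - j, ∃ i < b,
      j + word (vHigh (pInit π b hb) j) x = word (pInit π b hb) i ∧
      a + word (vHigh π a) x = word π i := by
    intro x hx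
    obtain ⟨i, hi, hij, rfl⟩ := exists_count_notMem_lowPos_eq (pInit π b hb) hx
    refine ⟨i, hi, word_vHigh _ hi hij, ?_⟩
    rw [count_congr fun t ht => not_congr (mem_lowPos_pInit π hb hj (ht.trans hi))]
    refine word_vHigh π (hi.trans_le hb) (not_lt.1 fun h => ?_)
    exact hij.not_gt ((word_pInit_lt_count_iff π hb hj hi).2 h)
  refine perm_ext_of_lt_iff fun x hx y hy => ?_
  obtain ⟨i, hi, h1, h2⟩ := key x hx
  obtain ⟨i', hi', h3, h4⟩ := key y hy
  have h5 := word_pInit_lt_iff π hb hi hi'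
  rw [word_pInit_lt_iff _ hjb hx hy]
  omega

/-- The set of `i` such that the letter of `π` at position `b + i` is smaller than `a`. -/
def lowPosTail (a b : ℕ) : Finset ℕ := {i ∈ range (n - b) | b + i ∈ lowPos π a}

theorem mem_lowPosTail {i : ℕ} (hi : i < n - b) : i ∈ lowPosTail π a b ↔ b + i ∈ lowPos π a := by
  simp [lowPosTail, hi]

theorem count_lowPos_le (ha : a ≤ n) : Nat.count (· ∈ lowPos π a) b ≤ a := by
  rw [Nat.count_eq_card_filter_range]
  refine (card_le_card fun i hi => ?_).trans (card_lowPos π ha).le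
  exact (mem_filter.1 hi).2

theorem count_lowPos_sub_le (hb : b ≤ n) (hj : Nat.count (· ∈ lowPos π a) b = j) :
    b - j ≤ n - a := by
  rw [← count_notMem _ hj]
  rcases lt_or_ge n a with h | ha
  · rw [Nat.count_iff_forall_not.2]
    · exact Nat.zero_le _
    · intro i hi
      have := word_lt π (hi.trans_le hb)
      rw [not_not, mem_lowPos π (hi.trans_le hb)]
      omega
  · refine (Nat.count_monotone _ hb).trans (count_notMem _ (count_lowPos π ha)).le

theorem card_lowPosTail (ha : a ≤ n) (hb : b ≤ n) (hj : Nat.count (· ∈ lowPos π a) b = j) :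
    #(lowPosTail π a b) = a - j := by
  have h1 := Nat.count_add (· ∈ lowPos π a) b (n - b)
  rw [Nat.add_sub_cancel' hb, count_lowPos π ha, hj,
    Nat.count_eq_card_filter_range] at h1
  exact (Nat.sub_eq_of_eq_add' h1).symm

theorem word_add_eq_shuffle (ha : a ≤ n) (hj : Nat.count (· ∈ lowPos π a) b = j)
    {i : ℕ} (hi : i < n - b) :
    word π (b + i) = shuffle (lowPosTail π a b) (fun t => word (vLow π a ha) (j + t))
      (fun t => a + word (vHigh π a) (b - j + t)) i := by
  rw [word_eq_shuffle π ha (by omega), shuffle, shuffle, Nat.count_add, Nat.count_add, hj,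
    count_notMem _ hj]
  simp only [mem_lowPosTail π hi]
  rw [count_congr (p := (· ∈ lowPosTail π a b)) fun t ht => mem_lowPosTail π (ht.trans hi),
    count_congr (p := (· ∉ lowPosTail π a b)) fun t ht =>
      not_congr (mem_lowPosTail π (ht.trans hi))]

/-- The set whose elements smaller than `b` are those of `L` and whose elements in `[b, n)` are the
translates of those of `M`. -/
def joinSets (n b : ℕ) (L M : Finset ℕ) : Finset ℕ :=
  {i ∈ range n | if i < b then i ∈ L else i - b ∈ M}

theorem mem_joinSets_of_lt (hb : b ≤ n) (L M : Finset ℕ) {i : ℕ} (hi : i < b) :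
    i ∈ joinSets n b L M ↔ i ∈ L := by
  simp [joinSets, hi, hi.trans_le hb]

theorem add_mem_joinSets (L M : Finset ℕ) {i : ℕ} (hi : i < n - b) :
    b + i ∈ joinSets n b L M ↔ i ∈ M := by
  simp [joinSets, (by omega : b + i < n)]

theorem joinSets_mem_powersetCard {r s : ℕ} (hb : b ≤ n) {L M : Finset ℕ}
    (hL : L ∈ powersetCard r (range b)) (hM : M ∈ powersetCard s (range (n - b))) :
    joinSets n b L M ∈ powersetCard (r + s) (range n) := by
  obtain ⟨hL1, hL2⟩ := mem_powersetCard.1 hL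
  obtain ⟨hM1, hM2⟩ := mem_powersetCard.1 hM
  refine mem_powersetCard.2 ⟨filter_subset _ _, ?_⟩
  rw [← count_mem_eq_card (joinSets n b L M) n (filter_subset _ _), ← Nat.add_sub_cancel' hb, Nat.count_add,
    Nat.add_sub_cancel' hb, count_congr fun i hi => mem_joinSets_of_lt hb L M hi,
    count_congr fun i hi => add_mem_joinSets L M hi, count_mem_eq_card _ _ hL1,
    count_mem_eq_card _ _ hM1, hL2, hM2]

theorem lowPos_eq_joinSets (hb : b ≤ n) (hj : Nat.count (· ∈ lowPos π a) b = j) :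
    lowPos π a = joinSets n b (lowPos (pInit π b hb) j) (lowPosTail π a b) := by
  ext i
  rcases lt_or_ge i n with hi | hi
  · rcases lt_or_ge i b with hib | hib
    · rw [mem_joinSets_of_lt hb _ _ hib, mem_lowPos_pInit π hb hj hib]
    · obtain ⟨t, rfl⟩ := Nat.exists_eq_add_of_le hib
      rw [add_mem_joinSets _ _ (by omega), mem_lowPosTail π (by omega)]
  · simp [lowPos, joinSets, hi.not_gt]

end Restriction

section Fiber

variable {a b ℓ j : ℕ} {σ : Equiv.Perm (Fin a)} {τ : Equiv.Perm (Fin b)}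

theorem mem_permsC_iff (ha : a ≤ ℓ) (hb : b ≤ ℓ) {π : Equiv.Perm (Fin ℓ)} :
    π ∈ permsC ℓ σ τ ↔ vLow π a ha = σ ∧ pInit π b hb = τ := by
  simp [permsC, ha, hb]

theorem mem_j2Set_iff :
    j ∈ j2Set σ τ ↔ ∃ (ha : j ≤ a) (hb : j ≤ b), pInit σ j ha = vLow τ j hb := by
  simp only [j2Set, mem_filter, mem_range, and_iff_right_iff_imp]
  rintro ⟨ha, hb, -⟩
  omega

theorem count_lowPos_mem_j2Set (ha : a ≤ ℓ) {π : Equiv.Perm (Fin ℓ)} (hb : b ≤ ℓ)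
    (hπ : π ∈ permsC ℓ σ τ) : Nat.count (· ∈ lowPos π a) b ∈ j2Set σ τ := by
  obtain ⟨rfl, rfl⟩ := (mem_permsC_iff ha hb).1 hπ
  exact mem_j2Set_iff.2 ⟨count_lowPos_le π ha, Nat.count_le _,
    (vLow_pInit π ha hb rfl _ _).symm⟩

open scoped Classical in
/-- The permutations in `S_ℓ(σ, τ)` with exactly `j` small letters at the first `b` positions
correspond to pairs of a position set for the remaining small letters and a pattern of the large
letters. -/
theorem sum_permsC_count_eq (ha : a ≤ ℓ) (hb : b ≤ ℓ) (hj : j ∈ j2Set σ τ) (hk : b - j ≤ ℓ - a)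
    (f : Finset ℕ → Equiv.Perm (Fin (ℓ - a)) → ℝ) :
    ∑ π ∈ permsC ℓ σ τ with Nat.count (· ∈ lowPos π a) b = j,
        f (lowPosTail π a b) (vHigh π a) =
      ∑ α : Equiv.Perm (Fin (ℓ - a)) with pInit α (b - j) hk = vHigh τ j,
        ∑ M ∈ powersetCard (a - j) (range (ℓ - b)), f M α := by
  obtain ⟨hja, hjb, hστ⟩ := mem_j2Set_iff.1 hj
  rw [← sum_product']
  refine sum_bij (fun π _ => (vHigh π a, lowPosTail π a b)) ?_ ?_ ?_ fun _ _ => rfl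
  · intro π hπ
    obtain ⟨hπ, hc⟩ := mem_filter.1 hπ
    obtain ⟨-, rfl⟩ := (mem_permsC_iff ha hb).1 hπ
    rw [mem_product, mem_filter_univ, mem_powersetCard]
    exact ⟨(vHigh_pInit π hb hc hk).symm, filter_subset _ _, card_lowPosTail π ha hb hc⟩
  · intro π hπ π' hπ' h
    obtain ⟨hπ, hc⟩ := mem_filter.1 hπ
    obtain ⟨hπ', hc'⟩ := mem_filter.1 hπ'
    obtain ⟨h1, h2⟩ := (mem_permsC_iff ha hb).1 hπ
    obtain ⟨h1', h2'⟩ := (mem_permsC_iff ha hb).1 hπ'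
    rw [Prod.mk.injEq] at h
    refine eq_of_decomposition ha ?_ (h1.trans h1'.symm) h.1
    rw [lowPos_eq_joinSets π hb hc, lowPos_eq_joinSets π' hb hc', h2, h2', h.2]
  · rintro ⟨α, M⟩ h
    rw [mem_product, mem_filter_univ] at h
    obtain ⟨hα, hM⟩ := h
    have hL := joinSets_mem_powersetCard hb (lowPos_mem_powersetCard τ hjb) hM
    rw [Nat.add_sub_cancel' hja] at hL
    obtain ⟨π, hπL, hπσ, hπα⟩ := exists_decomposition ha hL σ α
    have hc : Nat.count (· ∈ lowPos π a) b = j := by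
      rw [hπL, count_congr fun i hi => mem_joinSets_of_lt hb _ M hi,
        count_lowPos τ hjb]
    have hτ : pInit π b hb = τ := by
      refine eq_of_decomposition hjb ?_ ?_ ?_
      · ext i
        rcases lt_or_ge i b with hi | hi
        · rw [mem_lowPos_pInit π hb hc hi, hπL, mem_joinSets_of_lt hb _ M hi]
        · simp [lowPos, hi.not_gt]
      · rw [vLow_pInit π ha hb hc hja hjb, hπσ, hστ]
      · rw [vHigh_pInit π hb hc hk, hπα, hα]
    refine ⟨π, mem_filter.2 ⟨(mem_permsC_iff ha hb).2 ⟨hπσ, hτ⟩, hc⟩, ?_⟩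
    rw [Prod.mk.injEq]
    refine ⟨hπα, ?_⟩
    ext i
    rcases lt_or_ge i (ℓ - b) with hi | hi
    · rw [mem_lowPosTail π hi, hπL, add_mem_joinSets _ M hi]
    · refine iff_of_false (fun h => ?_) fun h => ?_
      · exact hi.not_gt (mem_range.1 (mem_filter.1 h).1)
      · exact hi.not_gt (mem_range.1 ((mem_powersetCard.1 hM).1 h))

theorem sum_permsC_count_eq_mul (ha : a ≤ ℓ) (hb : b ≤ ℓ) (hj : j ∈ j2Set σ τ)
    (hk : b - j ≤ ℓ - a) (p q : ℝ) :
    ∑ π ∈ permsC ℓ σ τ with Nat.count (· ∈ lowPos π a) b = j,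
        p ^ imaj (vHigh π a) * q ^ maj (pTail π b) =
      p ^ imaj (vHigh τ j) * q ^ maj (pTail σ j) * qBinom p (ℓ - a) (b - j) *
        qBinom q (ℓ - b) (a - j) * Apq p q (ℓ - a - (b - j)) := by
  classical
  obtain ⟨hja, hjb, hστ⟩ := mem_j2Set_iff.1 hj
  let f (M : Finset ℕ) (α : Equiv.Perm (Fin (ℓ - a))) : ℝ :=
    p ^ imaj α * q ^ wordMaj (ℓ - b) (shuffle M (fun t => word σ (j + t))
      fun t => a + word α (b - j + t))
  have h1 : ∀ π ∈ permsC ℓ σ τ, Nat.count (· ∈ lowPos π a) b = j →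
      p ^ imaj (vHigh π a) * q ^ maj (pTail π b) = f (lowPosTail π a b) (vHigh π a) := by
    intro π hπ hc
    obtain ⟨rfl, -⟩ := (mem_permsC_iff ha hb).1 hπ
    rw [maj_pTail, wordMaj_congr fun i hi => word_add_eq_shuffle π ha hc hi]
  have h2 : ∀ α : Equiv.Perm (Fin (ℓ - a)),
      ∑ M ∈ powersetCard (a - j) (range (ℓ - b)), f M α =
        q ^ maj (pTail σ j) * qBinom q (ℓ - b) (a - j) *
          (p ^ imaj α * q ^ maj (pTail α (b - j))) := by
    intro α
    have h := sum_shuffle q (fun t => word σ (j + t)) (fun t => a + word α (b - j + t)) (a - j)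
      (ℓ - a - (b - j)) fun i hi t _ => (word_lt σ (by omega)).trans_le (Nat.le_add_right _ _)
    rw [show a - j + (ℓ - a - (b - j)) = ℓ - b by omega, wordMaj_add_left, ← maj_pTail,
      ← maj_pTail] at h
    rw [← mul_sum, h, pow_add]
    ring
  rw [sum_congr rfl fun π hπ => h1 π (mem_filter.1 hπ).1 (mem_filter.1 hπ).2,
    sum_permsC_count_eq ha hb hj hk, sum_congr rfl fun α _ => h2 α, ← mul_sum, sum_pInit_eq]
  ring

end Fiber

/-- For `a + m = b + n = ℓ`, `σ ∈ S_a`, `τ ∈ S_b`,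
`Σ_{π ∈ S_ℓ(σ,τ)} p^{imaj(π_{>a})} q^{maj(π^{>b})}
  = Σ_{j ∈ J(σ,τ)} p^{imaj(τ_{>j})} q^{maj(σ^{>j})} [m choose k]_p [n choose k]_q A_k(p,q)`
with `k = n - a + j` (terms with `k < 0` vanish). -/
theorem stmt3 (a b n m ℓ : ℕ) (h1 : a + m = ℓ) (h2 : b + n = ℓ)
    (σ : Equiv.Perm (Fin a)) (τ : Equiv.Perm (Fin b)) (p q : ℝ) :
    ∑ π ∈ permsC ℓ σ τ, p ^ imaj (vHigh π a) * q ^ maj (pTail π b) =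
      ∑ j ∈ j2Set σ τ,
        if a ≤ n + j then
          p ^ imaj (vHigh τ j) * q ^ maj (pTail σ j) * qBinom p m (n + j - a) *
            qBinom q n (n + j - a) * Apq p q (n + j - a)
        else 0 := by
  obtain ⟨ha, hb⟩ : a ≤ ℓ ∧ b ≤ ℓ := by omega
  obtain rfl : m = ℓ - a := by omega
  obtain rfl : n = ℓ - b := by omega
  rw [← sum_fiberwise_of_maps_to fun π hπ => count_lowPos_mem_j2Set ha hb hπ]
  refine sum_congr rfl fun j hj => ?_
  obtain ⟨hja, hjb, -⟩ := mem_j2Set_iff.1 hj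
  split_ifs with hk
  · rw [sum_permsC_count_eq_mul ha hb hj (by omega)]
    have hp := qBinom_symm p (b - j) (ℓ - a - (b - j))
    have hq := qBinom_symm q (a - j) (ℓ - b - (a - j))
    rw [Nat.add_sub_cancel' (by omega)] at hp hq
    rw [hp, hq, show ℓ - a - (b - j) = ℓ - b + j - a by omega,
      show ℓ - b - (a - j) = ℓ - b + j - a by omega]
  · refine sum_eq_zero fun π hπ => absurd (count_lowPos_sub_le π hb (mem_filter.1 hπ).2) ?_
    omega

end QT
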